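/- Let r ≥ 3 be a natural number. The following 8(r−1) functions on SL(3,ℂ)^r are algebraically independent over ℂ in the ℂ-algebra of all functions SL(3,ℂ)^r → ℂ: the eight functions tr(X₁), tr(X₂), tr(X₁⁻¹), tr(X₂⁻¹), tr(X₁X₂), tr(X₁⁻¹X₂), tr(X₂⁻¹X₁), tr(X₁⁻¹X₂⁻¹), together with, for each k with 3 ≤ k ≤ r, the eight functions tr(X_k), tr(X_k⁻¹), tr(X₁X_k), tr(X₂X_k), tr(X₁X_k⁻¹), tr(X₁⁻¹X_k), tr(X₂⁻¹X_k), tr(X₂X_k⁻¹). -/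

import Mathlib

/-- `SL(3,ℂ)`. -/
abbrev SL3 := Matrix.SpecialLinearGroup (Fin 3) ℂ

/-- Trace of an element of `SL(3,ℂ)`, as the trace of the underlying matrix. -/
noncomputable def tr3 (X : SL3) : ℂ := Matrix.trace (X : Matrix (Fin 3) (Fin 3) ℂ)

/-- The eight functions tr X₁, tr X₂, tr X₁⁻¹, tr X₂⁻¹, tr X₁X₂, tr X₁⁻¹X₂,
tr X₂⁻¹X₁, tr X₁⁻¹X₂⁻¹ (indices here are 0-based: X₁ = X 0, X₂ = X 1). -/
noncomputable def baseBlock (r : ℕ) (hr : 3 ≤ r) (j : Fin 8) (X : Fin r → SL3) : ℂ :=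
  ![tr3 (X ⟨0, by omega⟩),
    tr3 (X ⟨1, by omega⟩),
    tr3 (X ⟨0, by omega⟩)⁻¹,
    tr3 (X ⟨1, by omega⟩)⁻¹,
    tr3 (X ⟨0, by omega⟩ * X ⟨1, by omega⟩),
    tr3 ((X ⟨0, by omega⟩)⁻¹ * X ⟨1, by omega⟩),
    tr3 ((X ⟨1, by omega⟩)⁻¹ * X ⟨0, by omega⟩),
    tr3 ((X ⟨0, by omega⟩)⁻¹ * (X ⟨1, by omega⟩)⁻¹)] j

namespace TraceInd

def cB : Matrix (Fin 8) (Fin 8) ℤ :=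
  !![1, 0, -1, 0, 0, 0, 0, 0;
    0, 0, 0, 0, 1, 1, 0, 0;
    1, -1, -1, 0, 0, 0, 0, 0;
    0, 0, 0, 0, 0, -1, 0, -1;
    1, 1, 0, -1, 1, 0, 0, 0;
    -2, 1, 0, 0, 1, 2, -1, 0;
    1, 1, 0, 0, -1, -1, -1, 0;
    -1, 1, 0, -1, 1, 0, 0, -1]

def cBInv : Matrix (Fin 8) (Fin 8) ℤ :=
  !![0, 2, 0, -1, -1, -1, 1, 1;
    1, 0, -1, 0, 0, 0, 0, 0;
    -1, 2, 0, -1, -1, -1, 1, 1;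
    1, -1, -1, 2, 1, 1, -1, -2;
    0, -3, 0, 3, 3, 2, -2, -3;
    0, 4, 0, -3, -3, -2, 2, 3;
    1, 1, -1, -1, -1, -1, 0, 1;
    0, -4, 0, 2, 3, 2, -2, -3]

theorem cBInv_mul : cBInv * cB = 1 := by decide +kernel

def cT : Matrix (Fin 8) (Fin 8) ℤ :=
  !![0, -1, 0, 1, -1, 0, 1, -2;
    0, 1, 1, 0, 1, 0, 0, 1;
    0, 0, -2, 0, -1, 0, 0, 0;
    0, 0, 1, 0, 0, -1, -1, 1;
    0, 1, 1, 1, 0, 0, 1, 1;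
    0, -1, 1, 0, 0, 0, 1, -2;
    -1, 0, 1, 0, 0, 0, -1, 3;
    1, 0, -1, 0, 0, 0, 1, -2]

def cTInv : Matrix (Fin 8) (Fin 8) ℤ :=
  !![-1, -3, -2, 0, 1, -1, 0, 1;
    -1, -1, 0, 0, 1, 0, -2, -2;
    -1, -2, -1, 0, 1, 0, -1, -1;
    2, 2, 0, 0, -1, -1, 1, 1;
    2, 4, 1, 0, -2, 0, 2, 2;
    -1, -3, -2, -1, 1, -1, -1, -1;
    0, 1, 1, 0, 0, 1, 1, 1;
    0, 0, 0, 0, 0, 0, 1, 1]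

theorem cTInv_mul : cTInv * cT = 1 := by decide +kernel

/-- Casting integer matrices to complex ones. -/
def phi : Matrix (Fin 3) (Fin 3) ℤ →+* Matrix (Fin 3) (Fin 3) ℂ :=
  (Int.castRingHom ℂ).mapMatrix

theorem trace_phi (M : Matrix (Fin 3) (Fin 3) ℤ) : (phi M).trace = (M.trace : ℤ) := by
  simp [phi, Matrix.trace]

/-- An integer matrix of determinant one as an element of `SL3`. -/
def ofZ (M : Matrix (Fin 3) (Fin 3) ℤ) (h : M.det = 1) : SL3 := ⟨phi M, by
  rw [phi, ← RingHom.map_det, h, map_one]⟩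

theorem ofZ_inv (M N : Matrix (Fin 3) (Fin 3) ℤ) (h : M.det = 1) (h' : M * N = 1) :
    (((ofZ M h)⁻¹ : SL3) : Matrix (Fin 3) (Fin 3) ℂ) = phi N := by
  have hN : N.det = 1 := by
    have := congrArg Matrix.det h'
    rwa [Matrix.det_mul, h, one_mul, Matrix.det_one] at this
  have : (ofZ M h)⁻¹ = ofZ N hN := by
    rw [inv_eq_iff_mul_eq_one]
    apply Subtype.ext
    change phi M * phi N = 1
    rw [← map_mul, h', map_one]
  rw [this]
  rfl

def aZ : Matrix (Fin 3) (Fin 3) ℤ := !![1, 1, -1; 0, 1, 0; 1, 0, 0]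
def aI : Matrix (Fin 3) (Fin 3) ℤ := !![0, 0, 1; 0, 1, 0; -1, 1, 1]
def mA : SL3 := ofZ aZ (by decide +kernel)
theorem mA_coe : (mA : Matrix (Fin 3) (Fin 3) ℂ) = phi aZ := rfl
theorem mA_inv : ((mA⁻¹ : SL3) : Matrix (Fin 3) (Fin 3) ℂ) = phi aI :=
  ofZ_inv _ _ _ (by decide +kernel)

def bZ : Matrix (Fin 3) (Fin 3) ℤ := !![0, 0, 1; 1, -1, 0; 1, 0, 0]
def bI : Matrix (Fin 3) (Fin 3) ℤ := !![0, 0, 1; 0, -1, 1; 1, 0, 0]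
def mB : SL3 := ofZ bZ (by decide +kernel)
theorem mB_coe : (mB : Matrix (Fin 3) (Fin 3) ℂ) = phi bZ := rfl
theorem mB_inv : ((mB⁻¹ : SL3) : Matrix (Fin 3) (Fin 3) ℂ) = phi bI :=
  ofZ_inv _ _ _ (by decide +kernel)

def cZ : Matrix (Fin 3) (Fin 3) ℤ := !![0, 0, -1; 0, -1, 0; -1, 1, 0]
def cI : Matrix (Fin 3) (Fin 3) ℤ := !![0, -1, -1; 0, -1, 0; -1, 0, 0]
def mC : SL3 := ofZ cZ (by decide +kernel)
theorem mC_coe : (mC : Matrix (Fin 3) (Fin 3) ℂ) = phi cZ := rfl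
theorem mC_inv : ((mC⁻¹ : SL3) : Matrix (Fin 3) (Fin 3) ℂ) = phi cI :=
  ofZ_inv _ _ _ (by decide +kernel)

/-- Square-zero rank one matrices spanning `sl(3)`. -/
def nZ (n : Fin 8) : Matrix (Fin 3) (Fin 3) ℤ :=
  ![!![0, 1, 0; 0, 0, 0; 0, 0, 0], !![0, 0, 1; 0, 0, 0; 0, 0, 0],
    !![0, 0, 0; 1, 0, 0; 0, 0, 0], !![0, 0, 0; 0, 0, 1; 0, 0, 0],
    !![0, 0, 0; 0, 0, 0; 1, 0, 0], !![0, 0, 0; 0, 0, 0; 0, 1, 0],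
    !![1, -1, 0; 1, -1, 0; 0, 0, 0], !![0, 0, 0; 0, 1, -1; 0, 1, -1]] n

def nM (n : Fin 8) : Matrix (Fin 3) (Fin 3) ℂ := phi (nZ n)

/-- One-parameter unipotent subgroups. -/
def uM (n : Fin 8) (t : ℂ) : SL3 := ⟨1 + t • nM n, by
  fin_cases n <;> simp [nM, nZ, phi, Matrix.det_fin_three] <;> ring⟩

theorem uM_zero (n : Fin 8) : uM n 0 = 1 := by
  ext i j; simp [uM]

theorem uM_coe (n : Fin 8) (t : ℂ) :
    (uM n t : Matrix (Fin 3) (Fin 3) ℂ) = 1 + t • nM n := rfl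

theorem nM_sq (n : Fin 8) : nM n * nM n = 0 := by
  have h : ∀ n, nZ n * nZ n = 0 := by decide +kernel
  rw [nM, ← map_mul, h, map_zero]

theorem uM_inv (n : Fin 8) (t : ℂ) : (uM n t)⁻¹ = uM n (-t) := by
  rw [inv_eq_iff_mul_eq_one]
  apply Subtype.ext
  rw [Matrix.SpecialLinearGroup.coe_mul, uM_coe, uM_coe, Matrix.SpecialLinearGroup.coe_one]
  simp [mul_add, add_mul, nM_sq]

def x1 (s : Fin 8 → ℂ) : SL3 := mA * uM 1 (s 0) * uM 3 (s 1) * uM 4 (s 2) * uM 5 (s 3)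
def x2 (s : Fin 8 → ℂ) : SL3 := mB * uM 0 (s 4) * uM 1 (s 5) * uM 3 (s 6) * uM 5 (s 7)
def x3 (s : Fin 8 → ℂ) : SL3 :=
  mC * uM 0 (s 0) * uM 1 (s 1) * uM 2 (s 2) * uM 3 (s 3) * uM 4 (s 4) * uM 5 (s 5)
    * uM 6 (s 6) * uM 7 (s 7)

theorem x1_zero : x1 0 = mA := by simp [x1, uM_zero]
theorem x2_zero : x2 0 = mB := by simp [x2, uM_zero]
theorem x3_zero : x3 0 = mC := by simp [x3, uM_zero]

noncomputable def fB (X Y : SL3) : Fin 8 → ℂ :=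
  ![tr3 X, tr3 Y, tr3 X⁻¹, tr3 Y⁻¹, tr3 (X * Y), tr3 (X⁻¹ * Y), tr3 (Y⁻¹ * X), tr3 (X⁻¹ * Y⁻¹)]

noncomputable def fT (X Y Z : SL3) : Fin 8 → ℂ :=
  ![tr3 Z, tr3 Z⁻¹, tr3 (X * Z), tr3 (Y * Z), tr3 (X * Z⁻¹), tr3 (X⁻¹ * Z), tr3 (Y⁻¹ * Z),
    tr3 (Y * Z⁻¹)]

/-- Integer derivatives in the first, second and third matrix. -/
def dL (n : Fin 8) : Fin 8 → ℤ :=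
  ![(aZ * nZ n).trace, 0, -(nZ n * aI).trace, 0, (aZ * nZ n * bZ).trace, -(nZ n * aI * bZ).trace,
    (bI * (aZ * nZ n)).trace, -(nZ n * aI * bI).trace]

def dR (n : Fin 8) : Fin 8 → ℤ :=
  ![0, (bZ * nZ n).trace, 0, -(nZ n * bI).trace, (aZ * (bZ * nZ n)).trace, (aI * (bZ * nZ n)).trace,
    -(nZ n * bI * aZ).trace, -(aI * (nZ n * bI)).trace]

def dT (n : Fin 8) : Fin 8 → ℤ :=
  ![(cZ * nZ n).trace, -(nZ n * cI).trace, (aZ * (cZ * nZ n)).trace, (bZ * (cZ * nZ n)).trace,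
    -(aZ * (nZ n * cI)).trace, (aI * (cZ * nZ n)).trace, (bI * (cZ * nZ n)).trace,
    -(bZ * (nZ n * cI)).trace]

theorem fB_left (n j : Fin 8) (t : ℂ) :
    fB (mA * uM n t) mB j = fB mA mB j + t * (dL n j : ℤ) := by
  fin_cases j <;> simp [fB, tr3, uM_inv, uM_coe, mul_add, add_mul, -Matrix.SpecialLinearGroup.coe_inv, dL] <;>
    simp only [mA_coe, mB_coe, mA_inv, mB_inv, nM, ← map_mul, trace_phi] <;> simp

theorem fB_right (n j : Fin 8) (t : ℂ) :
    fB mA (mB * uM n t) j = fB mA mB j + t * (dR n j : ℤ) := by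
  fin_cases j <;> simp [fB, tr3, uM_inv, uM_coe, mul_add, add_mul, -Matrix.SpecialLinearGroup.coe_inv, dR] <;>
    simp only [mA_coe, mB_coe, mA_inv, mB_inv, nM, ← map_mul, trace_phi] <;> simp

theorem fT_third (n j : Fin 8) (t : ℂ) :
    fT mA mB (mC * uM n t) j = fT mA mB mC j + t * (dT n j : ℤ) := by
  fin_cases j <;> simp [fT, tr3, uM_inv, uM_coe, mul_add, add_mul, -Matrix.SpecialLinearGroup.coe_inv, dT] <;>
    simp only [mA_coe, mB_coe, mC_coe, mA_inv, mB_inv, mC_inv, nM, ← map_mul, trace_phi] <;>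
    simp

theorem fB_line (i j : Fin 8) (t : ℂ) :
    fB (x1 (Pi.single i t)) (x2 (Pi.single i t)) j = fB mA mB j + t * (cB j i : ℤ) := by
  have h : ∀ i j, cB j i = ![dL 1, dL 3, dL 4, dL 5, dR 0, dR 1, dR 3, dR 5] i j := by
    decide +kernel
  rw [h]
  fin_cases i <;> simp [x1, x2, uM_zero, Pi.single_apply, fB_left, fB_right]

theorem fT_line (i j : Fin 8) (t : ℂ) :
    fT mA mB (x3 (Pi.single i t)) j = fT mA mB mC j + t * (cT j i : ℤ) := by
  have h : ∀ i j, cT j i = dT i j := by decide +kernel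
  rw [h]
  fin_cases i <;> simp [x3, uM_zero, Pi.single_apply, fT_third]

theorem inj_of_inv (c d : Matrix (Fin 8) (Fin 8) ℤ) (h : d * c = 1) (v : Fin 8 → ℂ)
    (hv : ∀ j, ∑ i, v i * (c j i : ℤ) = 0) : v = 0 := by
  have h1 : (d.map (Int.cast : ℤ → ℂ)) * (c.map (Int.cast : ℤ → ℂ)) = 1 := by
    have := congrArg (fun m => m.map (Int.castRingHom ℂ)) h
    rw [Matrix.map_mul] at this
    simpa using this
  have h2 : (c.map (Int.cast : ℤ → ℂ)).mulVec v = 0 := by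
    ext j
    simp only [Matrix.mulVec, dotProduct, Matrix.map_apply, Pi.zero_apply]
    rw [← hv j]
    exact Finset.sum_congr rfl fun i _ => mul_comm _ _
  rw [← Matrix.one_mulVec v, ← h1, ← Matrix.mulVec_mulVec, h2, Matrix.mulVec_zero]

/-! Smoothness -/

/-- Entries of the group element and of its inverse are smooth. -/
def Sm {E : Type*} [NormedAddCommGroup E] [NormedSpace ℂ E] (M : E → SL3) : Prop :=
  (∀ i j, ContDiff ℂ 1 fun s => (M s).1 i j) ∧ (∀ i j, ContDiff ℂ 1 fun s => (M s)⁻¹.1 i j)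

section
variable {E : Type*} [NormedAddCommGroup E] [NormedSpace ℂ E]

theorem Sm.const (A : SL3) : Sm (fun _ : E => A) :=
  ⟨fun _ _ => contDiff_const, fun _ _ => contDiff_const⟩

theorem Sm.inv {M : E → SL3} (h : Sm M) : Sm (fun s => (M s)⁻¹) :=
  ⟨h.2, by simpa only [inv_inv] using h.1⟩

theorem contDiff_mul_entry {M N : E → SL3} (hM : ∀ i j, ContDiff ℂ 1 fun s => (M s).1 i j)
    (hN : ∀ i j, ContDiff ℂ 1 fun s => (N s).1 i j) (i j : Fin 3) :
    ContDiff ℂ 1 fun s => (M s * N s).1 i j := by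
  have : (fun s => (M s * N s).1 i j) = fun s => ∑ k, (M s).1 i k * (N s).1 k j := by
    ext s
    exact Matrix.mul_apply
  rw [this]
  exact ContDiff.sum fun k _ => (hM i k).mul (hN k j)

theorem Sm.mul {M N : E → SL3} (hM : Sm M) (hN : Sm N) : Sm (fun s => M s * N s) := by
  refine ⟨contDiff_mul_entry hM.1 hN.1, ?_⟩
  simp only [mul_inv_rev]
  exact contDiff_mul_entry hN.2 hM.2

theorem Sm.uM (n : Fin 8) {t : E → ℂ} (ht : ContDiff ℂ 1 t) : Sm (fun s => uM n (t s)) := by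
  refine ⟨fun i j => ?_, fun i j => ?_⟩
  · simp only [uM_coe, Matrix.add_apply, Matrix.smul_apply, smul_eq_mul]
    fun_prop
  · simp only [uM_inv, uM_coe, Matrix.add_apply, Matrix.smul_apply, smul_eq_mul]
    fun_prop

theorem Sm.tr {M : E → SL3} (h : Sm M) : ContDiff ℂ 1 (fun s => tr3 (M s)) := by
  simp only [tr3, Matrix.trace_fin_three]
  exact ((h.1 0 0).add (h.1 1 1)).add (h.1 2 2)

theorem Sm.x1 {s : E → Fin 8 → ℂ} (hs : ∀ i, ContDiff ℂ 1 fun e => s e i) :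
    Sm (fun e => x1 (s e)) :=
  ((((Sm.const _).mul (.uM _ (hs _))).mul (.uM _ (hs _))).mul (.uM _ (hs _))).mul (.uM _ (hs _))

theorem Sm.x2 {s : E → Fin 8 → ℂ} (hs : ∀ i, ContDiff ℂ 1 fun e => s e i) :
    Sm (fun e => x2 (s e)) :=
  ((((Sm.const _).mul (.uM _ (hs _))).mul (.uM _ (hs _))).mul (.uM _ (hs _))).mul (.uM _ (hs _))

theorem Sm.x3 {s : E → Fin 8 → ℂ} (hs : ∀ i, ContDiff ℂ 1 fun e => s e i) :
    Sm (fun e => x3 (s e)) :=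
  ((((((((Sm.const _).mul (.uM _ (hs _))).mul (.uM _ (hs _))).mul (.uM _ (hs _))).mul
    (.uM _ (hs _))).mul (.uM _ (hs _))).mul (.uM _ (hs _))).mul (.uM _ (hs _))).mul (.uM _ (hs _))

theorem Sm.fB {X Y : E → SL3} (hX : Sm X) (hY : Sm Y) (j : Fin 8) :
    ContDiff ℂ 1 fun s => fB (X s) (Y s) j := by
  fin_cases j
  · exact hX.tr
  · exact hY.tr
  · exact hX.inv.tr
  · exact hY.inv.tr
  · exact (hX.mul hY).tr
  · exact (hX.inv.mul hY).tr
  · exact (hY.inv.mul hX).tr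
  · exact (hX.inv.mul hY.inv).tr

theorem Sm.fT {X Y Z : E → SL3} (hX : Sm X) (hY : Sm Y) (hZ : Sm Z) (j : Fin 8) :
    ContDiff ℂ 1 fun s => fT (X s) (Y s) (Z s) j := by
  fin_cases j
  · exact hZ.tr
  · exact hZ.inv.tr
  · exact (hX.mul hZ).tr
  · exact (hY.mul hZ).tr
  · exact (hX.mul hZ.inv).tr
  · exact (hX.inv.mul hZ).tr
  · exact (hY.inv.mul hZ).tr
  · exact (hY.mul hZ.inv).tr
end

/-- The parametrised family of trace values. -/
noncomputable def bigF (K : Type) (s : Fin 8 ⊕ K × Fin 8 → ℂ) : Fin 8 ⊕ K × Fin 8 → ℂ :=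
  Sum.elim (fun j => fB (x1 fun i => s (.inl i)) (x2 fun i => s (.inl i)) j)
    (fun p => fT (x1 fun i => s (.inl i)) (x2 fun i => s (.inl i))
      (x3 fun i => s (.inr (p.1, i))) p.2)

theorem bigF_contDiff (K : Type) [Fintype K] : ContDiff ℂ 1 (bigF K) := by
  rw [contDiff_pi]
  have h1 : Sm (fun s : Fin 8 ⊕ K × Fin 8 → ℂ => x1 fun i => s (.inl i)) :=
    Sm.x1 fun i => by fun_prop
  have h2 : Sm (fun s : Fin 8 ⊕ K × Fin 8 → ℂ => x2 fun i => s (.inl i)) :=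
    Sm.x2 fun i => by fun_prop
  rintro (j | ⟨k, j⟩)
  · exact Sm.fB h1 h2 j
  · exact Sm.fT h1 h2 (Sm.x3 fun i => by fun_prop) j

theorem fderiv_line {ι : Type} [Fintype ι] [DecidableEq ι] (F : (ι → ℂ) → ι → ℂ)
    (hF : ContDiff ℂ 1 F) (a b : ι) (c : ℂ)
    (h : ∀ t, F (Pi.single a t) b = F 0 b + t * c) : fderiv ℂ F 0 (Pi.single a 1) b = c := by
  have h1 : HasFDerivAt F (fderiv ℂ F 0) ((fun t : ℂ => t • (Pi.single a 1 : ι → ℂ)) 0) := by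
    simpa using (hF.differentiable one_ne_zero 0).hasFDerivAt
  have h2 : HasDerivAt (fun t : ℂ => t • (Pi.single a 1 : ι → ℂ)) (Pi.single a 1) 0 := by
    simpa using (hasDerivAt_id (0 : ℂ)).smul_const (Pi.single a 1 : ι → ℂ)
  have h3 := hasDerivAt_pi.1 (h1.comp_hasDerivAt 0 h2) b
  have h4 : HasDerivAt (fun t : ℂ => F 0 b + t * c) c 0 := by
    simpa using ((hasDerivAt_id (0 : ℂ)).mul_const c).const_add (F 0 b)
  refine h3.unique ?_
  refine h4.congr_of_eventuallyEq (Filter.Eventually.of_forall fun t => ?_)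
  change F (t • Pi.single a 1) b = F 0 b + t * c
  rw [← h t, ← Pi.single_smul, smul_eq_mul, mul_one]

theorem bigF_range (K : Type) [Fintype K] [DecidableEq K] : Set.range (bigF K) ∈ nhds (bigF K 0) := by
  set L := fderiv ℂ (bigF K) 0 with hL
  have hc := bigF_contDiff K
  have e1 : ∀ i j, L (Pi.single (.inl i) 1) (.inl j) = (cB j i : ℤ) := by
    intro i j
    apply fderiv_line _ hc
    intro t
    have : (fun i' => (Pi.single (Sum.inl i) t : Fin 8 ⊕ K × Fin 8 → ℂ) (.inl i')) =
        Pi.single i t := by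
      ext i'; simp [Pi.single_apply]
    have := fB_line i j t
    simp only [bigF, Sum.elim_inl, *]
    congr 1
    change _ = fB (x1 0) (x2 0) j
    rw [x1_zero, x2_zero]
  have z : ∀ (k : K) (i : Fin 8) (t : ℂ),
      (fun i' => (Pi.single (Sum.inr (k, i)) t : Fin 8 ⊕ K × Fin 8 → ℂ) (.inl i')) = 0 := by
    intro k i t
    ext i'; simp [Pi.single_apply]
  have e2 : ∀ k i j, L (Pi.single (.inr (k, i)) 1) (.inl j) = 0 := by
    intro k i j
    apply fderiv_line _ hc
    intro t
    simp only [bigF, Sum.elim_inl, z, mul_zero, add_zero]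
    rfl
  have e3 : ∀ k i j, L (Pi.single (.inr (k, i)) 1) (.inr (k, j)) = (cT j i : ℤ) := by
    intro k i j
    apply fderiv_line _ hc
    intro t
    have : (fun i' => (Pi.single (Sum.inr (k, i)) t : Fin 8 ⊕ K × Fin 8 → ℂ) (.inr (k, i'))) =
        Pi.single i t := by
      ext i'; simp [Pi.single_apply]
    simp only [bigF, Sum.elim_inr, z, this, x1_zero, x2_zero]
    rw [fT_line]
    congr 1
    change _ = fT (x1 0) (x2 0) (x3 0) j
    rw [x1_zero, x2_zero, x3_zero]
  have e4 : ∀ k k' i j, k' ≠ k → L (Pi.single (.inr (k, i)) 1) (.inr (k', j)) = 0 := by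
    intro k k' i j hk
    apply fderiv_line _ hc
    intro t
    have : (fun i' => (Pi.single (Sum.inr (k, i)) t : Fin 8 ⊕ K × Fin 8 → ℂ) (.inr (k', i'))) =
        0 := by
      ext i'; simp [Pi.single_apply, hk]
    simp only [bigF, Sum.elim_inr, z, this, mul_zero, add_zero]
    rfl
  have key : ∀ s b, L s b = (∑ i, s (.inl i) * L (Pi.single (.inl i) 1) b) +
      ∑ k, ∑ i, s (.inr (k, i)) * L (Pi.single (.inr (k, i)) 1) b := by
    intro s b
    conv_lhs => rw [pi_eq_sum_univ' s]
    rw [map_sum, Finset.sum_apply, Fintype.sum_sum_type, Fintype.sum_prod_type]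
    simp only [map_smul, Pi.smul_apply, smul_eq_mul]
  have inj : Function.Injective (L : (Fin 8 ⊕ K × Fin 8 → ℂ) →ₗ[ℂ] (Fin 8 ⊕ K × Fin 8 → ℂ)) := by
    rw [← LinearMap.ker_eq_bot, LinearMap.ker_eq_bot']
    intro s hs
    have hs' : ∀ b, L s b = 0 := fun b => congrFun hs b
    have h0 : (fun i => s (.inl i)) = 0 := by
      apply inj_of_inv cB cBInv cBInv_mul
      intro j
      have := hs' (.inl j)
      rw [key] at this
      simpa [e1, e2] using this
    have h0' : ∀ i, s (.inl i) = 0 := congrFun h0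
    have h1 : ∀ k, (fun i => s (.inr (k, i))) = 0 := by
      intro k
      apply inj_of_inv cT cTInv cTInv_mul
      intro j
      have := hs' (.inr (k, j))
      rw [key, Finset.sum_eq_single k] at this
      · simpa [e3, h0'] using this
      · intro k' _ hk
        simp [e4 k' k _ j hk.symm]
      · simp
    ext (i | ⟨k, i⟩)
    · exact h0' i
    · exact congrFun (h1 k) i
  have surj : L.range = ⊤ := LinearMap.range_eq_top.2 (LinearMap.injective_iff_surjective.1 inj)
  have := (hc.contDiffAt.hasStrictFDerivAt (x := 0) one_ne_zero).map_nhds_eq_of_surj surj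
  rw [← this]
  exact Filter.mem_map.2 (Filter.univ_mem' fun s => ⟨s, rfl⟩)

theorem poly_zero {ι : Type} [Fintype ι] (P : MvPolynomial ι ℂ) (S : Set (ι → ℂ)) (x : ι → ℂ)
    (hS : S ∈ nhds x) (h : ∀ y ∈ S, MvPolynomial.eval y P = 0) : P = 0 := by
  obtain ⟨ε, hε, hb⟩ := Metric.mem_nhds_iff.1 hS
  have hinf : ∀ i, (Metric.ball (x i) ε).Infinite := fun i =>
    infinite_of_mem_nhds (x i) (Metric.ball_mem_nhds _ hε)
  refine MvPolynomial.funext_set (fun i => Metric.ball (x i) ε) hinf fun y hy => ?_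
  rw [map_zero]
  refine h y (hb ?_)
  rw [ball_pi _ hε]
  exact hy

end TraceInd

open TraceInd in
theorem trace_functions_algebraically_independent
    (r : ℕ) (hr : 3 ≤ r) :
    AlgebraicIndependent ℂ
      (Sum.elim (fun j : Fin 8 => baseBlock r hr j)
        (fun p : {k : Fin r // 2 ≤ (k : ℕ)} × Fin 8 => fun X : Fin r → SL3 =>
          ![tr3 (X p.1.1),
            tr3 (X p.1.1)⁻¹,
            tr3 (X ⟨0, by omega⟩ * X p.1.1),
            tr3 (X ⟨1, by omega⟩ * X p.1.1),
            tr3 (X ⟨0, by omega⟩ * (X p.1.1)⁻¹),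
            tr3 ((X ⟨0, by omega⟩)⁻¹ * X p.1.1),
            tr3 ((X ⟨1, by omega⟩)⁻¹ * X p.1.1),
            tr3 (X ⟨1, by omega⟩ * (X p.1.1)⁻¹)] p.2)) := by
  rw [algebraicIndependent_iff]
  intro P hP
  refine poly_zero P _ _ (bigF_range {k : Fin r // 2 ≤ (k : ℕ)}) ?_
  rintro _ ⟨s, rfl⟩
  let X : Fin r → SL3 := fun m =>
    if m.1 = 0 then x1 fun i => s (.inl i)
    else if m.1 = 1 then x2 fun i => s (.inl i)
    else if h : 2 ≤ m.1 then x3 fun i => s (.inr (⟨m, h⟩, i)) else 1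
  have hX0 : X ⟨0, by omega⟩ = x1 fun i => s (.inl i) := by simp [X]
  have hX1 : X ⟨1, by omega⟩ = x2 fun i => s (.inl i) := by simp [X]
  have hX2 : ∀ k : {k : Fin r // 2 ≤ (k : ℕ)}, X k.1 = x3 fun i => s (.inr (k, i)) := by
    rintro ⟨k, hk⟩
    have h0 : k.1 ≠ 0 := by omega
    have h1 : k.1 ≠ 1 := by omega
    simp only [X, h0, h1, hk, if_false, dif_pos]
  have h := congrFun hP X
  refine Eq.trans ?_ h
  have hev : ∀ (Q : MvPolynomial (Fin 8 ⊕ {k : Fin r // 2 ≤ (k : ℕ)} × Fin 8) ℂ)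
      (G : (Fin 8 ⊕ {k : Fin r // 2 ≤ (k : ℕ)} × Fin 8) → (Fin r → SL3) → ℂ),
      MvPolynomial.aeval G Q X = MvPolynomial.eval (fun a => G a X) Q := by
    intro Q G
    induction Q using MvPolynomial.induction_on with
    | C a => simp [MvPolynomial.algebraMap_eq]
    | add p q hp hq => simp [hp, hq]
    | mul_X p a hp => simp [hp]
  rw [hev]
  congr 2
  ext (j | ⟨k, j⟩)
  · simp only [bigF, Sum.elim_inl, baseBlock, hX0, hX1, fB]
  · simp only [bigF, Sum.elim_inr, hX0, hX1, hX2, fT]
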